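/- Let (X,b,μ) be a weighted graph satisfying (FC), U, W : X → ℝ with U ≥ 0 and W ≥ 0, and suppose there are constants c₁ ≥ 0 and c₂ ≥ 0 with |∇W|²(x) ≤ c₁ + c₂·W(x) for all x ∈ X. Then for all u ∈ C_c(X): |Im(∑_x μ(x)·W(x)·u(x)·conj((L₀u)(x)))| ≤ (c₁/4)·‖u‖² + ((c₂+2)/4)·‖(L_U + W + 1)u‖·‖u‖, where norms are in ℓ²(X,μ) and (L_U + W + 1)u denotes L_U u + (W+1)·u. -/

import Mathlib

open scoped ENNReal

noncomputable section

/-- The formal discrete Laplacian `(L₀ f)(x) = μ(x)⁻¹ ∑_y b(x,y)(f(x) − f(y))`. -/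
def lap0 {X : Type*} (b : X → X → ℝ) (μ : X → ℝ) (f : X → ℂ) (x : X) : ℂ :=
  (μ x : ℂ)⁻¹ * ∑' y, (b x y : ℂ) * (f x - f y)

/-- The formal discrete Schrödinger operator `(L_U f)(x) = (L₀ f)(x) + U(x) f(x)`. -/
def lapV {X : Type*} (b : X → X → ℝ) (μ : X → ℝ) (U : X → ℝ) (f : X → ℂ) (x : X) : ℂ :=
  lap0 b μ f x + (U x : ℂ) * f x

/-- The squared gradient `|∇W|²(x) = μ(x)⁻¹ ∑_y b(x,y)(W(x)−W(y))²`, computed in `ℝ≥0∞`. -/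
def gradSq {X : Type*} (b : X → X → ℝ) (μ : X → ℝ) (W : X → ℝ) (x : X) : ℝ≥0∞ :=
  (ENNReal.ofReal (μ x))⁻¹ * ∑' y, ENNReal.ofReal (b x y * (W x - W y) ^ 2)


theorem aux_lap {X : Type*} (b : X → X → ℝ) (hb_sum : ∀ x, Summable fun z => b x z)
    (u : X → ℂ) (S : Finset X) (hS : ∀ x, x ∉ S → u x = 0) (x : X) :
    ∑' y, (b x y : ℂ) * (u x - u y) =
      ((∑' y, b x y : ℝ) : ℂ) * u x - ∑ y ∈ S, (b x y : ℂ) * u y := by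
  have h1 : HasSum (fun y => (b x y : ℂ) * u x) (((∑' y, b x y : ℝ) : ℂ) * u x) :=
    (Complex.hasSum_ofReal.mpr (hb_sum x).hasSum).mul_right _
  have h2 : HasSum (fun y => (b x y : ℂ) * u y) (∑ y ∈ S, (b x y : ℂ) * u y) :=
    hasSum_sum_of_ne_finset_zero (fun y hy => by simp [hS y hy])
  have := (h1.sub h2).tsum_eq
  simpa [mul_sub] using this

theorem aux_summable {X : Type*} (b : X → X → ℝ) (μ : X → ℝ)
    (hb_symm : ∀ x y, b x y = b y x)
    (hb_sum : ∀ x, Summable fun z => b x z)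
    (hμ_pos : ∀ x, 0 < μ x)
    (hFC : ∀ x, Summable fun y => μ y * (b x y / μ y) ^ 2)
    (U W : X → ℝ)
    (u : X → ℂ) (S : Finset X) (hS : ∀ x, x ∉ S → u x = 0) :
    Summable fun x => μ x * ‖lapV b μ U u x + ((W x + 1 : ℝ) : ℂ) * u x‖ ^ 2 := by
  have h1 : Summable fun x => (S.card : ℝ) * ∑ y ∈ S, μ x * (b y x / μ x) ^ 2 * ‖u y‖ ^ 2 := by
    refine Summable.mul_left _ (summable_sum fun y _ => ?_)
    exact (hFC y).mul_right _
  have h2 : Summable fun x => μ x * ‖(μ x : ℂ)⁻¹ * ∑ y ∈ S, (b x y : ℂ) * u y‖ ^ 2 := by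
    refine Summable.of_nonneg_of_le (fun x => ?_) (fun x => ?_) h1
    · exact mul_nonneg (hμ_pos x).le (sq_nonneg _)
    · have hm := hμ_pos x
      have e : ‖(μ x : ℂ)⁻¹ * ∑ y ∈ S, (b x y : ℂ) * u y‖ ≤ ∑ y ∈ S, |b y x| / μ x * ‖u y‖ := by
        rw [Finset.mul_sum]
        refine (norm_sum_le _ _).trans (Finset.sum_le_sum fun y _ => le_of_eq ?_)
        rw [norm_mul, norm_mul, norm_inv, Complex.norm_real, Complex.norm_real, Real.norm_eq_abs,
          Real.norm_eq_abs, abs_of_pos hm, hb_symm x y]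
        ring
      calc _ ≤ μ x * (∑ y ∈ S, |b y x| / μ x * ‖u y‖) ^ 2 := by gcongr
        _ ≤ μ x * ((S.card : ℝ) * ∑ y ∈ S, (|b y x| / μ x * ‖u y‖) ^ 2) := by
            gcongr
            exact sq_sum_le_card_mul_sum_sq
        _ = _ := by
            rw [mul_left_comm, Finset.mul_sum]
            congr 1
            refine Finset.sum_congr rfl fun y _ => ?_
            rw [mul_pow, div_pow, sq_abs, div_pow]
            ring
  refine (summable_congr_cofinite ?_).mp h2
  have : ∀ᶠ x in Filter.cofinite, x ∉ S := S.finite_toSet.eventually_cofinite_notMem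
  filter_upwards [this] with x hx
  rw [lapV, lap0, aux_lap b hb_sum u S hS x, hS x hx]
  simp

theorem aux_main {X : Type*} (b : X → X → ℝ) (μ : X → ℝ)
    (hb_symm : ∀ x y, b x y = b y x)
    (hb_nonneg : ∀ x y, 0 ≤ b x y) (W D : X → ℝ) (c₁ c₂ : ℝ) (u : X → ℂ) (S : Finset X)
    (hD : ∀ x, ∑ y ∈ S, b x y ≤ D x)
    (hg : ∀ x, ∑ y ∈ S, b x y * (W x - W y) ^ 2 ≤ μ x * (c₁ + c₂ * W x)) :
    |∑ x ∈ S, ∑ y ∈ S, b x y * W x * (u x * star (u y)).im| ≤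
      c₁ / 4 * (∑ x ∈ S, μ x * ‖u x‖ ^ 2) + c₂ / 4 * (∑ x ∈ S, μ x * W x * ‖u x‖ ^ 2) +
      1 / 2 * (∑ x ∈ S, (D x * ‖u x‖ ^ 2 - ∑ y ∈ S, b x y * (u x * star (u y)).re)) := by
  have e1 : 2 * ∑ x ∈ S, ∑ y ∈ S, b x y * W x * (u x * star (u y)).im =
      ∑ x ∈ S, ∑ y ∈ S, b x y * (W x - W y) * (u x * star (u y)).im := by
    rw [two_mul]
    nth_rewrite 2 [Finset.sum_comm]
    simp only [← Finset.sum_add_distrib]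
    refine Finset.sum_congr rfl fun x _ => Finset.sum_congr rfl fun y _ => ?_
    rw [hb_symm y x]
    simp
    ring
  have e2 : |2 * ∑ x ∈ S, ∑ y ∈ S, b x y * W x * (u x * star (u y)).im| ≤
      ∑ x ∈ S, ∑ y ∈ S, (b x y * (W x - W y) ^ 2 * ‖u x‖ ^ 2 / 2 +
        (b x y * ‖u x‖ ^ 2 / 2 + b y x * ‖u y‖ ^ 2 / 2 - b x y * (u x * star (u y)).re)) := by
    rw [e1]
    refine (Finset.abs_sum_le_sum_abs _ _).trans (Finset.sum_le_sum fun x _ => ?_)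
    refine (Finset.abs_sum_le_sum_abs _ _).trans (Finset.sum_le_sum fun y _ => ?_)
    rw [hb_symm y x, mul_assoc, abs_mul, abs_of_nonneg (hb_nonneg x y)]
    have : |(W x - W y) * (u x * star (u y)).im| ≤ (W x - W y) ^ 2 * ‖u x‖ ^ 2 / 2 +
        (‖u x‖ ^ 2 / 2 + ‖u y‖ ^ 2 / 2 - (u x * star (u y)).re) := by
      rw [← Complex.normSq_eq_norm_sq, ← Complex.normSq_eq_norm_sq, Complex.normSq_apply,
        Complex.normSq_apply]
      simp only [Complex.star_def, Complex.mul_im, Complex.mul_re, Complex.conj_re, Complex.conj_im]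
      set p := (u x).re
      set q := (u x).im
      set r := (u y).re
      set s := (u y).im
      set w := W x - W y
      rw [abs_le]
      constructor
      · nlinarith [sq_nonneg (w * p - (s - q)), sq_nonneg (w * q + (r - p)),
          sq_nonneg (w * p + (s - q)), sq_nonneg (w * q - (r - p))]
      · nlinarith [sq_nonneg (w * p - (s - q)), sq_nonneg (w * q + (r - p)),
          sq_nonneg (w * p + (s - q)), sq_nonneg (w * q - (r - p))]
    have h := mul_le_mul_of_nonneg_left this (hb_nonneg x y)
    linarith
  have e3 : ∑ x ∈ S, ∑ y ∈ S, (b x y * (W x - W y) ^ 2 * ‖u x‖ ^ 2 / 2 +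
        (b x y * ‖u x‖ ^ 2 / 2 + b y x * ‖u y‖ ^ 2 / 2 - b x y * (u x * star (u y)).re)) =
      ∑ x ∈ S, ((∑ y ∈ S, b x y * (W x - W y) ^ 2) * ‖u x‖ ^ 2 / 2 +
        ((∑ y ∈ S, b x y) * ‖u x‖ ^ 2 - ∑ y ∈ S, b x y * (u x * star (u y)).re)) := by
    simp only [Finset.sum_add_distrib, Finset.sum_sub_distrib]
    rw [Finset.sum_comm (f := fun x y => b y x * ‖u y‖ ^ 2 / 2)]
    simp only [Finset.sum_mul, Finset.sum_div]
    have : ∑ x ∈ S, ∑ y ∈ S, b x y * ‖u x‖ ^ 2 = 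
      ∑ x ∈ S, ∑ y ∈ S, b x y * ‖u x‖ ^ 2 / 2 + ∑ x ∈ S, ∑ y ∈ S, b x y * ‖u x‖ ^ 2 / 2 := by
      simp only [← Finset.sum_add_distrib, add_halves]
    rw [this]
  have e4 : ∑ x ∈ S, ((∑ y ∈ S, b x y * (W x - W y) ^ 2) * ‖u x‖ ^ 2 / 2 +
        ((∑ y ∈ S, b x y) * ‖u x‖ ^ 2 - ∑ y ∈ S, b x y * (u x * star (u y)).re)) ≤
      ∑ x ∈ S, ((μ x * (c₁ + c₂ * W x)) * ‖u x‖ ^ 2 / 2 +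
        (D x * ‖u x‖ ^ 2 - ∑ y ∈ S, b x y * (u x * star (u y)).re)) := by
    refine Finset.sum_le_sum fun x _ => ?_
    have := hg x
    have := hD x
    gcongr
  have e5 : ∑ x ∈ S, ((μ x * (c₁ + c₂ * W x)) * ‖u x‖ ^ 2 / 2 +
        (D x * ‖u x‖ ^ 2 - ∑ y ∈ S, b x y * (u x * star (u y)).re)) =
      c₁ / 2 * (∑ x ∈ S, μ x * ‖u x‖ ^ 2) + c₂ / 2 * (∑ x ∈ S, μ x * W x * ‖u x‖ ^ 2) +
      (∑ x ∈ S, (D x * ‖u x‖ ^ 2 - ∑ y ∈ S, b x y * (u x * star (u y)).re)) := by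
    rw [Finset.mul_sum, Finset.mul_sum, ← Finset.sum_add_distrib, ← Finset.sum_add_distrib]
    refine Finset.sum_congr rfl fun x _ => ?_
    ring
  rw [abs_mul, abs_two, e3] at e2
  linarith

/-- Let `(X,b,μ)` be a weighted graph satisfying (FC), `U, W : X → ℝ` with
`U ≥ 0`, `W ≥ 0`, and suppose there are constants `c₁ ≥ 0` and `c₂ ≥ 0` with
`|∇W|²(x) ≤ c₁ + c₂·W(x)` for all `x`.  Then for all `u ∈ C_c(X)`:
`|Im(∑_x μ(x) W(x) u(x) conj((L₀u)(x)))| ≤ (c₁/4)‖u‖² + ((c₂+2)/4)‖(L_U+W+1)u‖·‖u‖`,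
where the norms are taken in `ℓ²(X,μ)`. -/
theorem im_estimate_full {X : Type*} [Countable X]
    (b : X → X → ℝ) (μ : X → ℝ)
    (hb_symm : ∀ x y, b x y = b y x)
    (hb_nonneg : ∀ x y, 0 ≤ b x y)
    (hb_loop : ∀ x, b x x = 0)
    (hb_sum : ∀ x, Summable fun z => b x z)
    (hμ_pos : ∀ x, 0 < μ x)
    (hFC : ∀ x, Summable fun y => μ y * (b x y / μ y) ^ 2)
    (U W : X → ℝ) (hU : ∀ x, 0 ≤ U x) (hW : ∀ x, 0 ≤ W x)
    (c₁ c₂ : ℝ) (hc₁ : 0 ≤ c₁) (hc₂ : 0 ≤ c₂)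
    (hgrad : ∀ x, gradSq b μ W x ≤ ENNReal.ofReal (c₁ + c₂ * W x)) :
    ∀ u : X → ℂ, (Function.support u).Finite →
      |(∑' x, (μ x : ℂ) * (W x : ℂ) * u x * star (lap0 b μ u x)).im| ≤
        c₁ / 4 * (∑' x, μ x * ‖u x‖ ^ 2) +
          (c₂ + 2) / 4 *
            Real.sqrt (∑' x, μ x * ‖lapV b μ U u x + ((W x + 1 : ℝ) : ℂ) * u x‖ ^ 2) *
            Real.sqrt (∑' x, μ x * ‖u x‖ ^ 2) := by
  intro u hu
  set S : Finset X := hu.toFinset with hSdef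
  have hS : ∀ x, x ∉ S → u x = 0 := by
    intro x hx
    by_contra h
    exact hx (by simpa [hSdef] using h)
  set D : X → ℝ := fun x => ∑' y, b x y with hDdef
  have hD : ∀ x, ∑ y ∈ S, b x y ≤ D x := fun x =>
    (hb_sum x).sum_le_tsum S (fun y _ => hb_nonneg x y)
  have hD0 : ∀ x, 0 ≤ D x := fun x => tsum_nonneg (hb_nonneg x)
  have hg : ∀ x, ∑ y ∈ S, b x y * (W x - W y) ^ 2 ≤ μ x * (c₁ + c₂ * W x) := by
    intro x
    have hm := hμ_pos x
    have hc : 0 ≤ c₁ + c₂ * W x := add_nonneg hc₁ (mul_nonneg hc₂ (hW x))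
    have h := hgrad x
    rw [gradSq, ← ENNReal.ofReal_inv_of_pos hm] at h
    have h2 : ENNReal.ofReal ((μ x)⁻¹ * ∑ y ∈ S, b x y * (W x - W y) ^ 2) ≤
        ENNReal.ofReal (c₁ + c₂ * W x) := by
      refine le_trans ?_ h
      rw [ENNReal.ofReal_mul (inv_nonneg.mpr hm.le), ENNReal.ofReal_sum_of_nonneg
        (fun y _ => mul_nonneg (hb_nonneg x y) (sq_nonneg _))]
      gcongr
      exact ENNReal.sum_le_tsum S
    rw [ENNReal.ofReal_le_ofReal_iff hc] at h2
    rwa [inv_mul_le_iff₀ hm] at h2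
  have hsum := aux_summable b μ hb_symm hb_sum hμ_pos hFC U W u S hS
  have hmain := aux_main b μ hb_symm hb_nonneg W D c₁ c₂ u S hD hg
  set F : X → ℂ := fun x => lapV b μ U u x + ((W x + 1 : ℝ) : ℂ) * u x with hF
  have hlap : ∀ x, (μ x : ℂ) * lap0 b μ u x = (D x : ℂ) * u x - ∑ y ∈ S, (b x y : ℂ) * u y := by
    intro x
    have : (μ x : ℂ) ≠ 0 := by exact_mod_cast (hμ_pos x).ne'
    rw [lap0, aux_lap b hb_sum u S hS x, mul_inv_cancel_left₀ this]
  have hn : ∑' x, μ x * ‖u x‖ ^ 2 = ∑ x ∈ S, μ x * ‖u x‖ ^ 2 :=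
    tsum_eq_sum (fun x hx => by simp [hS x hx])
  have hlhs : (∑' x, (μ x : ℂ) * (W x : ℂ) * u x * star (lap0 b μ u x)).im =
      - ∑ x ∈ S, ∑ y ∈ S, b x y * W x * (u x * star (u y)).im := by
    rw [tsum_eq_sum (s := S) (fun x hx => by simp [hS x hx]), Complex.im_sum,
      ← Finset.sum_neg_distrib]
    refine Finset.sum_congr rfl fun x _ => ?_
    have : (μ x : ℂ) * (W x : ℂ) * u x * star (lap0 b μ u x) =
        (W x : ℂ) * (u x * star ((μ x : ℂ) * lap0 b μ u x)) := by
      simp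
      ring
    rw [this, hlap, star_sub, star_sum, mul_sub, Finset.mul_sum, Complex.im_ofReal_mul,
      Complex.sub_im, Complex.im_sum]
    have h0 : (u x * star ((D x : ℂ) * u x)).im = 0 := by
      simp
      ring
    rw [h0, zero_sub, mul_neg, Finset.mul_sum]
    congr 1
    refine Finset.sum_congr rfl fun y _ => ?_
    simp
    ring
  have hre : ∀ x, μ x * W x * ‖u x‖ ^ 2 + μ x * U x * ‖u x‖ ^ 2 + μ x * ‖u x‖ ^ 2 +
      (D x * ‖u x‖ ^ 2 - ∑ y ∈ S, b x y * (u x * star (u y)).re) ≤ μ x * (‖F x‖ * ‖u x‖) := by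
    intro x
    have h1 : μ x * (F x * star (u x)).re ≤ μ x * (‖F x‖ * ‖u x‖) := by
      refine mul_le_mul_of_nonneg_left ?_ (hμ_pos x).le
      refine (Complex.re_le_norm _).trans (le_of_eq ?_)
      rw [norm_mul, norm_star]
    refine le_trans (le_of_eq ?_) h1
    rw [← Complex.re_ofReal_mul]
    have : (μ x : ℂ) * (F x * star (u x)) =
        ((μ x : ℂ) * lap0 b μ u x) * star (u x) +
          ((μ x * (U x + W x + 1) : ℝ) : ℂ) * (u x * star (u x)) := by
      simp only [hF, lapV]
      push_cast
      ring
    rw [this, hlap, sub_mul, Finset.sum_mul, Complex.add_re, Complex.sub_re, Complex.re_sum,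
      mul_assoc (D x : ℂ), Complex.re_ofReal_mul, Complex.re_ofReal_mul]
    have hu2 : (u x * star (u x)).re = ‖u x‖ ^ 2 := by
      rw [← Complex.normSq_eq_norm_sq, Complex.normSq_apply]
      simp
    rw [hu2]
    have : ∑ y ∈ S, b x y * (u x * star (u y)).re =
        ∑ y ∈ S, ((b x y : ℂ) * u y * star (u x)).re := by
      refine Finset.sum_congr rfl fun y _ => ?_
      rw [mul_assoc, Complex.re_ofReal_mul]
      simp only [Complex.star_def, Complex.mul_re, Complex.conj_re, Complex.conj_im]
      ring
    rw [this]
    ring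
  have hsumre := Finset.sum_le_sum (s := S) (fun x _ => hre x)
  simp only [Finset.sum_add_distrib] at hsumre
  have hcs : ∑ x ∈ S, μ x * (‖F x‖ * ‖u x‖) ≤
      Real.sqrt (∑' x, μ x * ‖F x‖ ^ 2) * Real.sqrt (∑' x, μ x * ‖u x‖ ^ 2) := by
    have h := Real.sum_mul_le_sqrt_mul_sqrt S (fun x => Real.sqrt (μ x) * ‖F x‖)
      (fun x => Real.sqrt (μ x) * ‖u x‖)
    have q : ∀ x, Real.sqrt (μ x) ^ 2 = μ x := fun x => Real.sq_sqrt (hμ_pos x).le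
    simp only [mul_pow, q] at h
    rw [hn]
    calc _ = ∑ x ∈ S, Real.sqrt (μ x) * ‖F x‖ * (Real.sqrt (μ x) * ‖u x‖) := by
          refine Finset.sum_congr rfl fun x _ => ?_
          nth_rewrite 1 [← q x]
          ring
      _ ≤ _ := h
      _ ≤ _ := by
          gcongr
          exact hsum.sum_le_tsum S (fun x _ => mul_nonneg (hμ_pos x).le (sq_nonneg _))
  have hP : 0 ≤ ∑ x ∈ S, μ x * W x * ‖u x‖ ^ 2 := Finset.sum_nonneg fun x _ =>
    mul_nonneg (mul_nonneg (hμ_pos x).le (hW x)) (sq_nonneg _)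
  have hQ : 0 ≤ ∑ x ∈ S, μ x * U x * ‖u x‖ ^ 2 := Finset.sum_nonneg fun x _ =>
    mul_nonneg (mul_nonneg (hμ_pos x).le (hU x)) (sq_nonneg _)
  have hR : 0 ≤ ∑ x ∈ S, μ x * ‖u x‖ ^ 2 := Finset.sum_nonneg fun x _ =>
    mul_nonneg (hμ_pos x).le (sq_nonneg _)
  have hE : 0 ≤ ∑ x ∈ S, (D x * ‖u x‖ ^ 2 - ∑ y ∈ S, b x y * (u x * star (u y)).re) := by
    have h := aux_main b (fun _ => 0) hb_symm hb_nonneg (fun _ => 0) D 0 0 u S hD (by simp)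
    have h' := (abs_nonneg _).trans h
    simp only [zero_mul, zero_div, zero_add] at h'
    linarith
  rw [hlhs, abs_neg, mul_assoc, hn]
  rw [hn] at hcs
  set N := Real.sqrt (∑' x, μ x * ‖F x‖ ^ 2) * Real.sqrt (∑ x ∈ S, μ x * ‖u x‖ ^ 2)
  have hPN : ∑ x ∈ S, μ x * W x * ‖u x‖ ^ 2 ≤ N := by linarith
  have hEN : ∑ x ∈ S, (D x * ‖u x‖ ^ 2 - ∑ y ∈ S, b x y * (u x * star (u y)).re) ≤ N := by
    linarith
  have := mul_le_mul_of_nonneg_left hPN (show 0 ≤ c₂ / 4 by positivity)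
  linarith
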